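/- Let p be an odd prime, μ an additive Haar measure on ℚ_p normalized so that μ(ℤ_p) = 1, and ε ∈ ℤ_p a unit (‖ε‖ = 1) which is not a square in ℚ_p; set Q(x,y) = x² − ε·y². Let Φ : ℚ_p × ℚ_p → ℂ be a locally constant compactly supported function. Then for every complex s with Re(s) > 0 the integral Z(s) = ∫_{ℚ_p²} Φ(x,y)·‖Q(x,y)‖^{s−1} d(μ×μ) converges absolutely (the integrand being 0 where Q(x,y) = 0), and there exist M ∈ ℕ and a polynomial P with complex coefficients such that (1 − p^{−2s}) · Z(s) = p^{M s} · P(p^{−s}) for all s with Re(s) > 0. In particular Z(s) is a rational function of p^{−s} whose denominator divides (1 − p^{−s})(1 + p^{−s}). -/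

import Mathlib

open MeasureTheory
open scoped Classical

lemma Padic.norm_sub_le_max {p : ℕ} [Fact p.Prime] (x y : ℚ_[p]) : ‖x - y‖ ≤ max ‖x‖ ‖y‖ := by
  simpa [sub_eq_add_neg] using Padic.nonarchimedean x (-y)

/-- The balls of radius `p ^ (m + 1)` split into `p` translates of the ball of radius `p ^ m`. -/
lemma Padic.closedBall_zpow_succ (p : ℕ) [Fact p.Prime] (m : ℤ) :
    Metric.closedBall (0 : ℚ_[p]) ((p : ℝ) ^ (m + 1)) =
      ⋃ i ∈ Finset.range p,
        Metric.closedBall ((i : ℚ_[p]) * (p : ℚ_[p]) ^ (-(m + 1))) ((p : ℝ) ^ m) := by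
  have hp0 : (p : ℚ_[p]) ≠ 0 := by exact_mod_cast (Fact.out : p.Prime).ne_zero
  have hpR : (0 : ℝ) < p := by exact_mod_cast (Fact.out : p.Prime).pos
  have hp1 : (1 : ℝ) ≤ p := by exact_mod_cast (Fact.out : p.Prime).one_le
  ext x
  simp only [Metric.mem_closedBall, Set.mem_iUnion, Finset.mem_range, dist_eq_norm, sub_zero,
    exists_prop]
  constructor
  · intro hx
    have hu : ‖x * (p : ℚ_[p]) ^ (m + 1)‖ ≤ 1 := by
      rw [norm_mul, Padic.norm_p_zpow, zpow_neg, ← div_eq_mul_inv]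
      exact div_le_one_of_le₀ hx (by positivity)
    let u : ℤ_[p] := ⟨x * (p : ℚ_[p]) ^ (m + 1), hu⟩
    refine ⟨u.zmodRepr, u.zmodRepr_lt_p, ?_⟩
    have h := u.norm_sub_zmodRepr_lt_one
    rw [PadicInt.norm_def] at h
    push_cast at h
    rw [Padic.norm_le_pow_iff_norm_lt_pow_add_one]
    have key : x - (u.zmodRepr : ℚ_[p]) * (p : ℚ_[p]) ^ (-(m + 1)) =
        ((u : ℚ_[p]) - u.zmodRepr) * (p : ℚ_[p]) ^ (-(m + 1)) := by
      rw [sub_mul]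
      congr 1
      change x = x * (p : ℚ_[p]) ^ (m + 1) * (p : ℚ_[p]) ^ (-(m + 1))
      rw [mul_assoc, ← zpow_add₀ hp0]
      simp
    rw [key, norm_mul, Padic.norm_p_zpow, neg_neg]
    exact mul_lt_of_lt_one_left (by positivity) h
  · rintro ⟨i, -, hi⟩
    have h1 : ‖(i : ℚ_[p]) * (p : ℚ_[p]) ^ (-(m + 1))‖ ≤ (p : ℝ) ^ (m + 1) := by
      rw [norm_mul, Padic.norm_p_zpow, neg_neg]
      exact mul_le_of_le_one_left (by positivity) (by exact_mod_cast Padic.norm_int_le_one (i : ℤ))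
    have h2 : (p : ℝ) ^ m ≤ (p : ℝ) ^ (m + 1) := zpow_le_zpow_right₀ hp1 (by lia)
    have h3 := Padic.nonarchimedean (x - (i : ℚ_[p]) * (p : ℚ_[p]) ^ (-(m + 1)))
      ((i : ℚ_[p]) * (p : ℚ_[p]) ^ (-(m + 1)))
    rw [sub_add_cancel] at h3
    exact h3.trans (max_le (hi.trans h2) h1)

lemma Padic.disjoint_closedBall_zpow (p : ℕ) [Fact p.Prime] (m : ℤ) {i j : ℕ} (hi : i < p)
    (hj : j < p) (hij : i ≠ j) :
    Disjoint (Metric.closedBall ((i : ℚ_[p]) * (p : ℚ_[p]) ^ (-(m + 1))) ((p : ℝ) ^ m))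
      (Metric.closedBall ((j : ℚ_[p]) * (p : ℚ_[p]) ^ (-(m + 1))) ((p : ℝ) ^ m)) := by
  have hpR : (0 : ℝ) < p := by exact_mod_cast (Fact.out : p.Prime).pos
  rw [Set.disjoint_left]
  intro x hx hy
  rw [Metric.mem_closedBall, dist_eq_norm] at hx hy
  have h := Padic.norm_sub_le_max (x - (j : ℚ_[p]) * (p : ℚ_[p]) ^ (-(m + 1)))
    (x - (i : ℚ_[p]) * (p : ℚ_[p]) ^ (-(m + 1)))
  have h' := h.trans (max_le hy hx)
  rw [Padic.norm_le_pow_iff_norm_lt_pow_add_one, sub_sub_sub_cancel_left, ← sub_mul, norm_mul,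
    Padic.norm_p_zpow, neg_neg] at h'
  have h'' : ‖(i : ℚ_[p]) - j‖ < 1 := by
    by_contra! hc
    exact absurd h' (not_lt.mpr (le_mul_of_one_le_left (by positivity) hc))
  have h3 : (p : ℤ) ∣ (i : ℤ) - j := by
    rw [← Padic.norm_intCast_lt_one_iff]
    push_cast
    exact h''
  have h4 := Int.eq_zero_of_abs_lt_dvd h3 (by rw [abs_lt]; lia)
  lia

/-- The Haar measure of a `p`-adic ball is its radius. -/
lemma Padic.measureReal_closedBall_zpow (p : ℕ) [Fact p.Prime] [MeasurableSpace ℚ_[p]]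
    [BorelSpace ℚ_[p]] (μ : Measure ℚ_[p]) [μ.IsAddHaarMeasure]
    (hμ : μ {x : ℚ_[p] | ‖x‖ ≤ 1} = 1) (m : ℤ) :
    μ.real (Metric.closedBall 0 ((p : ℝ) ^ m)) = (p : ℝ) ^ m := by
  have hpR : (p : ℝ) ≠ 0 := by exact_mod_cast (Fact.out : p.Prime).ne_zero
  have step (m : ℤ) : μ.real (Metric.closedBall 0 ((p : ℝ) ^ (m + 1))) =
      p * μ.real (Metric.closedBall 0 ((p : ℝ) ^ m)) := by
    rw [Padic.closedBall_zpow_succ, measureReal_biUnion_finset _ _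
      fun _ _ => measure_closedBall_lt_top.ne]
    · simp_rw [measureReal_def, Measure.addHaar_closedBall_center]
      simp
    · intro i hi j hj hij
      exact Padic.disjoint_closedBall_zpow p m (by simpa using hi) (by simpa using hj) hij
    · exact fun _ _ => measurableSet_closedBall
  induction m using Int.induction_on with
  | zero =>
    have : Metric.closedBall (0 : ℚ_[p]) ((p : ℝ) ^ (0 : ℤ)) = {x | ‖x‖ ≤ 1} := by
      ext; simp
    rw [this, measureReal_def, hμ]
    simp
  | succ i ih => rw [step, ih, zpow_add_one₀ hpR, mul_comm]
  | pred i ih =>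
    have h := step (-(i : ℤ) - 1)
    rw [sub_add_cancel, ih] at h
    rw [← mul_right_inj' hpR, ← h, ← zpow_one_add₀ hpR]
    congr 1
    ring

/-- The Haar measure of a sphere in `ℚ_p²` for the sup norm. -/
lemma Padic.measureReal_prod_sphere_zpow (p : ℕ) [Fact p.Prime] [MeasurableSpace ℚ_[p]]
    [BorelSpace ℚ_[p]] (μ : Measure ℚ_[p]) [μ.IsAddHaarMeasure]
    (hμ : μ {x : ℚ_[p] | ‖x‖ ≤ 1} = 1) (m : ℤ) :
    (μ.prod μ).real (Metric.sphere 0 ((p : ℝ) ^ m)) =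
      ((p : ℝ) ^ m) ^ 2 * (1 - ((p : ℝ) ^ 2)⁻¹) := by
  have hpR : (p : ℝ) ≠ 0 := by exact_mod_cast (Fact.out : p.Prime).ne_zero
  have hp1 : (1 : ℝ) ≤ p := by exact_mod_cast (Fact.out : p.Prime).one_le
  have ball (m : ℤ) : (μ.prod μ).real (Metric.closedBall 0 ((p : ℝ) ^ m)) =
      ((p : ℝ) ^ m) ^ 2 := by
    rw [← Prod.mk_zero_zero, ← closedBall_prod_same, measureReal_prod_prod,
      Padic.measureReal_closedBall_zpow p μ hμ, sq]
  have hs : Metric.sphere (0 : ℚ_[p] × ℚ_[p]) ((p : ℝ) ^ m) =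
      Metric.closedBall 0 ((p : ℝ) ^ m) \ Metric.closedBall 0 ((p : ℝ) ^ (m - 1)) := by
    ext q
    have : ‖q‖ < (p : ℝ) ^ m ↔ ‖q‖ ≤ (p : ℝ) ^ (m - 1) := by
      simp only [Prod.norm_def, max_lt_iff, max_le_iff,
        Padic.norm_lt_pow_iff_norm_le_pow_sub_one]
    simp only [mem_sphere_zero_iff_norm, Set.mem_sdiff, mem_closedBall_zero_iff, ← this]
    constructor
    · intro h
      simp [h]
    · rintro ⟨h1, h2⟩
      exact le_antisymm h1 (not_lt.mp h2)
  rw [hs, measureReal_sdiff (Metric.closedBall_subset_closedBall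
    (zpow_le_zpow_right₀ hp1 (by lia))) measurableSet_closedBall measure_closedBall_lt_top.ne,
    ball, ball, zpow_sub_one₀ hpR]
  field_simp

/-- An approximate square root of a `p`-adic unit, `p` odd, lifts to a square root. -/
lemma Padic.exists_sq_eq_of_norm_sq_sub_lt_one (p : ℕ) [Fact p.Prime] (hp : p ≠ 2) {ε u : ℚ_[p]}
    (hε : ‖ε‖ = 1) (hu : ‖u‖ = 1) (h : ‖u ^ 2 - ε‖ < 1) : ∃ y : ℚ_[p], y ^ 2 = ε := by
  let a : ℤ_[p] := ⟨u, hu.le⟩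
  let e : ℤ_[p] := ⟨ε, hε.le⟩
  have h2 : ‖(2 : ℤ_[p])‖ = 1 := by
    have : ‖((2 : ℕ) : ℚ_[p])‖ = 1 := by
      rw [Padic.norm_natCast_eq_one_iff]
      exact (Nat.coprime_primes Fact.out Nat.prime_two).mpr hp
    rw [PadicInt.norm_def]
    exact_mod_cast this
  have ha : ‖a‖ = 1 := hu
  have hd : ‖(Polynomial.X ^ 2 - Polynomial.C e : Polynomial ℤ_[p]).derivative.aeval a‖ = 1 := by
    simp only [Polynomial.derivative_sub, Polynomial.derivative_X_pow, Polynomial.derivative_C,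
      sub_zero, map_mul, norm_mul, map_pow, Polynomial.aeval_X, Nat.cast_ofNat, map_ofNat, h2]
    simp [ha]
  obtain ⟨z, hz, -⟩ := hensels_lemma (p := p) (R := ℤ_[p])
    (F := Polynomial.X ^ 2 - Polynomial.C e) (a := a) (by
      rw [hd, one_pow]
      rw [map_sub, map_pow, Polynomial.aeval_X, Polynomial.aeval_C, PadicInt.norm_def]
      exact_mod_cast h)
  refine ⟨z, ?_⟩
  have hz' : z ^ 2 - e = 0 := by simpa using hz
  have := congrArg (fun t : ℤ_[p] => (t : ℚ_[p])) (sub_eq_zero.mp hz')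
  simpa [e] using this

/-- The unramified norm form has absolute value the square of the sup norm. -/
lemma Padic.norm_sq_sub_mul_sq (p : ℕ) [Fact p.Prime] (hp : p ≠ 2) {ε : ℚ_[p]}
    (hε : ‖ε‖ = 1) (hεsq : ¬∃ y : ℚ_[p], y ^ 2 = ε) (q : ℚ_[p] × ℚ_[p]) :
    ‖q.1 ^ 2 - ε * q.2 ^ 2‖ = ‖q‖ ^ 2 := by
  obtain ⟨x, y⟩ := q
  rw [Prod.norm_def]
  have hey : ‖-(ε * y ^ 2)‖ = ‖y‖ ^ 2 := by simp [hε]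
  by_cases hxy : ‖x‖ = ‖y‖
  · by_cases hy : y = 0
    · have hx : x = 0 := by simpa [hy] using hxy
      simp [hx, hy]
    have hu : ‖x / y‖ = 1 := by rw [norm_div, hxy, div_self (norm_ne_zero_iff.mpr hy)]
    have h1 : ‖(x / y) ^ 2 - ε‖ = 1 := by
      refine le_antisymm ?_ (not_lt.mp fun h =>
        hεsq (Padic.exists_sq_eq_of_norm_sq_sub_lt_one p hp hε hu h))
      exact (Padic.norm_sub_le_max _ _).trans (by simp [hu, hε])
    have : x ^ 2 - ε * y ^ 2 = ((x / y) ^ 2 - ε) * y ^ 2 := by field_simp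
    rw [this, norm_mul, h1]
    simp [hxy]
  · have hne : ‖x ^ 2‖ ≠ ‖-(ε * y ^ 2)‖ := by
      rw [hey, norm_pow]
      exact fun h => hxy ((pow_left_inj₀ (norm_nonneg _) (norm_nonneg _) two_ne_zero).mp h)
    rw [sub_eq_add_neg, Padic.add_eq_max_of_ne hne, hey, norm_pow]
    rcases le_total ‖x‖ ‖y‖ with h | h
    · rw [max_eq_right h, max_eq_right (pow_le_pow_left₀ (norm_nonneg _) h 2)]
    · rw [max_eq_left h, max_eq_left (pow_le_pow_left₀ (norm_nonneg _) h 2)]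

/-- A geometric-type series with eventually constant coefficients is a rational function. -/
lemma one_sub_sq_mul_of_hasSum_eventually_const {b : ℕ → ℂ} {C : ℂ} {K : ℕ}
    (hb : ∀ k, K ≤ k → b k = C) {A x Z : ℂ} (hx : ‖x‖ < 1)
    (h : HasSum (fun k => b k * (A * x ^ (2 * k))) Z) :
    (1 - x ^ 2) * Z = A * Polynomial.eval x
      ((1 - Polynomial.X ^ 2) * ∑ k ∈ Finset.range K, Polynomial.C (b k) * Polynomial.X ^ (2 * k) +
        Polynomial.C C * Polynomial.X ^ (2 * K)) := by
  have hx2 : ‖x ^ 2‖ < 1 := by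
    rw [norm_pow]
    exact pow_lt_one₀ (norm_nonneg _) hx two_ne_zero
  have hne : 1 - x ^ 2 ≠ 0 := fun h0 => by
    rw [← sub_eq_zero.mp h0] at hx2
    simp at hx2
  have h1 := (hasSum_nat_add_iff' K).mpr h
  have h2 : HasSum (fun k => b (k + K) * (A * x ^ (2 * (k + K))))
      (C * A * x ^ (2 * K) * (1 - x ^ 2)⁻¹) := by
    have heq : (fun k => b (k + K) * (A * x ^ (2 * (k + K)))) =
        fun k => C * A * x ^ (2 * K) * (x ^ 2) ^ k := by
      funext k
      rw [hb _ (by lia)]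
      ring
    rw [heq]
    exact (hasSum_geometric_of_norm_lt_one hx2).mul_left (C * A * x ^ (2 * K))
  have h3 := sub_eq_iff_eq_add.mp (h1.unique h2)
  rw [h3]
  simp only [Polynomial.eval_add, Polynomial.eval_mul, Polynomial.eval_sub, Polynomial.eval_one,
    Polynomial.eval_pow, Polynomial.eval_X, Polynomial.eval_finsetSum, Polynomial.eval_C]
  have h4 : ∑ k ∈ Finset.range K, b k * (A * x ^ (2 * k)) =
      A * ∑ k ∈ Finset.range K, b k * x ^ (2 * k) := by
    rw [Finset.mul_sum]
    exact Finset.sum_congr rfl fun _ _ => by ring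
  rw [h4]
  field_simp
  ring

open scoped Classical

/-- The sup norm of a nonzero vector of `ℚ_p²` is an integral power of `p`. -/
lemma Padic.exists_prod_norm_eq_zpow {p : ℕ} [Fact p.Prime] {q : ℚ_[p] × ℚ_[p]} (hq : q ≠ 0) :
    ∃ n : ℤ, ‖q‖ = (p : ℝ) ^ n := by
  have aux (x : ℚ_[p]) (hx : ‖q‖ = ‖x‖) : ∃ n : ℤ, ‖q‖ = (p : ℝ) ^ n := by
    have hx0 : x ≠ 0 := by
      rintro rfl
      exact hq (by simpa using hx)
    exact ⟨_, hx.trans (Padic.norm_eq_zpow_neg_valuation hx0)⟩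
  rcases max_choice ‖q.1‖ ‖q.2‖ with h | h
  · exact aux q.1 h
  · exact aux q.2 h

lemma Complex.ofReal_zpow_sq_cpow {p : ℕ} (hp : p ≠ 0) (n : ℤ) (w : ℂ) :
    (((((p : ℝ) ^ n) ^ 2 : ℝ)) : ℂ) ^ w = (p : ℂ) ^ (2 * n * w) := by
  have hpR : (0 : ℝ) < p := by exact_mod_cast Nat.pos_of_ne_zero hp
  have h0 : ((p : ℝ) ^ n) ^ 2 ≠ 0 := by positivity
  rw [Complex.cpow_def_of_ne_zero (by exact_mod_cast h0),
    Complex.cpow_def_of_ne_zero (by exact_mod_cast hp), ← Complex.ofReal_log (by positivity),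
    Real.log_pow, Real.log_zpow, ← Complex.natCast_log]
  push_cast
  ring_nf

lemma Complex.cpow_two_mul_sub_mul {p : ℕ} (hp : p ≠ 0) (N k : ℕ) (s : ℂ) :
    (p : ℂ) ^ (2 * (((N : ℤ) - k : ℤ) : ℂ) * (s - 1)) =
      ((p : ℂ) ^ ((N : ℤ) - k)) ^ (-2 : ℤ) *
        ((p : ℂ) ^ (((2 * N : ℕ) : ℂ) * s) * ((p : ℂ) ^ (-s)) ^ (2 * k)) := by
  have hp' : (p : ℂ) ≠ 0 := by exact_mod_cast hp
  rw [← Complex.cpow_nat_mul, ← zpow_mul, ← Complex.cpow_intCast, ← Complex.cpow_add _ _ hp',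
    ← Complex.cpow_add _ _ hp']
  congr 1
  push_cast
  ring

/-- Non-Archimedean nonsplit Mellin transform (`p` odd, `Q(x,y) = x² − εy²` the unramified norm
form): for a Schwartz–Bruhat function `Φ` on `ℚ_p²`, the zeta integral
`Z(s) = ∫ Φ(x,y)·‖Q(x,y)‖^{s−1}` converges for `Re s > 0` and is a rational function of `p^{−s}`
whose denominator divides `(1 − p^{−s})(1 + p^{−s})`. -/
theorem stmt_14 (p : ℕ) [Fact p.Prime] (hp : p ≠ 2)
    [MeasurableSpace ℚ_[p]] [BorelSpace ℚ_[p]]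
    (μ : Measure ℚ_[p]) [μ.IsAddHaarMeasure]
    (hμ : μ {x : ℚ_[p] | ‖x‖ ≤ 1} = 1)
    (ε : ℚ_[p]) (hε : ‖ε‖ = 1) (hεsq : ¬∃ y : ℚ_[p], y ^ 2 = ε)
    (Φ : ℚ_[p] × ℚ_[p] → ℂ) (hΦ : IsLocallyConstant Φ) (hΦc : HasCompactSupport Φ) :
    (∀ s : ℂ, 0 < s.re →
      Integrable (fun q : ℚ_[p] × ℚ_[p] =>
        if q.1 ^ 2 - ε * q.2 ^ 2 = 0 then 0
        else Φ q * ((‖q.1 ^ 2 - ε * q.2 ^ 2‖ : ℝ) : ℂ) ^ (s - 1)) (μ.prod μ)) ∧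
    ∃ (M : ℕ) (P : Polynomial ℂ), ∀ s : ℂ, 0 < s.re →
      (1 - (p : ℂ) ^ (-(2 * s))) *
          ∫ q : ℚ_[p] × ℚ_[p],
            (if q.1 ^ 2 - ε * q.2 ^ 2 = 0 then 0
             else Φ q * ((‖q.1 ^ 2 - ε * q.2 ^ 2‖ : ℝ) : ℂ) ^ (s - 1)) ∂(μ.prod μ) =
        (p : ℂ) ^ ((M : ℂ) * s) * P.eval ((p : ℂ) ^ (-s)) := by
  have hp0 : p ≠ 0 := (Fact.out : p.Prime).ne_zero
  have hpR : (0 : ℝ) < p := by exact_mod_cast Nat.pos_of_ne_zero hp0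
  have hp1 : (1 : ℝ) < p := by exact_mod_cast (Fact.out : p.Prime).one_lt
  have hpC : (p : ℂ) ≠ 0 := by exact_mod_cast hp0
  obtain ⟨N, hN⟩ : ∃ N : ℕ, ∀ q, Φ q ≠ 0 → ‖q‖ ≤ (p : ℝ) ^ (N : ℤ) := by
    obtain ⟨R, hR⟩ := hΦc.isBounded.exists_norm_le
    obtain ⟨N, hN⟩ := pow_unbounded_of_one_lt R hp1
    refine ⟨N, fun q hq => (hR q (subset_tsupport _ hq)).trans ?_⟩
    exact_mod_cast hN.le
  obtain ⟨K, hK⟩ : ∃ K : ℕ, ∀ q, ‖q‖ ≤ (p : ℝ) ^ ((N : ℤ) - K) → Φ q = Φ 0 := by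
    obtain ⟨δ, hδ, hball⟩ := Metric.eventually_nhds_iff.mp (hΦ.eventually_eq 0)
    obtain ⟨K, hK⟩ := exists_pow_lt_of_lt_one (show 0 < δ / (p : ℝ) ^ N by positivity)
      (inv_lt_one_of_one_lt₀ hp1)
    refine ⟨K, fun q hq => hball ?_⟩
    rw [dist_zero_right]
    refine hq.trans_lt ?_
    rw [lt_div_iff₀ (by positivity), inv_pow, inv_mul_eq_div] at hK
    rwa [zpow_sub₀ hpR.ne', zpow_natCast, zpow_natCast]
  obtain ⟨B, hB⟩ := hΦc.exists_bound_of_continuous hΦ.continuous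
  have hΦi : Integrable Φ (μ.prod μ) := hΦ.continuous.integrable_of_hasCompactSupport hΦc
  let T (k : ℕ) : Set (ℚ_[p] × ℚ_[p]) := Metric.sphere 0 ((p : ℝ) ^ ((N : ℤ) - k))
  have hTm (k : ℕ) : MeasurableSet (T k) := Metric.isClosed_sphere.measurableSet
  have hTd : Pairwise (Function.onFun Disjoint T) := by
    intro i j hij
    refine Set.disjoint_left.mpr fun q hi hj => hij ?_
    rw [mem_sphere_zero_iff_norm] at hi hj
    have := zpow_right_injective₀ hpR hp1.ne' (hi.symm.trans hj)
    lia
  let f (s : ℂ) (q : ℚ_[p] × ℚ_[p]) : ℂ :=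
    if q.1 ^ 2 - ε * q.2 ^ 2 = 0 then 0
      else Φ q * ((‖q.1 ^ 2 - ε * q.2 ^ 2‖ : ℝ) : ℂ) ^ (s - 1)
  have hfT (s : ℂ) (k : ℕ) (q) (hq : q ∈ T k) :
      f s q = Φ q * (p : ℂ) ^ (2 * (((N : ℤ) - k : ℤ) : ℂ) * (s - 1)) := by
    rw [mem_sphere_zero_iff_norm] at hq
    have hQ := Padic.norm_sq_sub_mul_sq p hp hε hεsq q
    rw [hq] at hQ
    have hne : q.1 ^ 2 - ε * q.2 ^ 2 ≠ 0 := by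
      rw [← norm_ne_zero_iff, hQ]
      positivity
    simp only [f, if_neg hne, hQ]
    rw [Complex.ofReal_zpow_sq_cpow hp0]
  have hfsupp (s : ℂ) : Function.support (f s) ⊆ ⋃ k, T k := by
    intro q hq
    have hQ : q.1 ^ 2 - ε * q.2 ^ 2 ≠ 0 := fun h => hq (by simp [f, h])
    have hΦq : Φ q ≠ 0 := fun h => hq (by simp [f, h])
    have hq0 : q ≠ 0 := by
      rintro rfl
      simp at hQ
    obtain ⟨n, hn⟩ := Padic.exists_prod_norm_eq_zpow hq0
    have hle : n ≤ N := by
      have := hN q hΦq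
      rwa [hn, zpow_le_zpow_iff_right₀ hp1] at this
    refine Set.mem_iUnion.mpr ⟨((N : ℤ) - n).toNat, ?_⟩
    rw [mem_sphere_zero_iff_norm, hn]
    congr 1
    lia
  have hfi (s : ℂ) (k : ℕ) : IntegrableOn (f s) (T k) (μ.prod μ) :=
    IntegrableOn.congr_fun (hΦi.mul_const _).integrableOn (fun q hq => (hfT s k q hq).symm) (hTm k)
  have hvol (k : ℕ) := Padic.measureReal_prod_sphere_zpow p μ hμ ((N : ℤ) - k)
  have hx (s : ℂ) (hs : 0 < s.re) : ‖(p : ℂ) ^ (-s)‖ < 1 := by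
    rw [Complex.norm_natCast_cpow_of_pos (Nat.pos_of_ne_zero hp0)]
    exact Real.rpow_lt_one_of_one_lt_of_neg hp1 (by simpa using hs)
  have hint (s : ℂ) (hs : 0 < s.re) : Integrable (f s) (μ.prod μ) := by
    rw [← integrableOn_iff_integrable_of_support_subset (hfsupp s)]
    refine integrableOn_iUnion_of_summable_integral_norm (hfi s) ?_
    have hx2 : ‖(p : ℂ) ^ (-s)‖ ^ 2 < 1 := pow_lt_one₀ (norm_nonneg _) (hx s hs) two_ne_zero
    refine Summable.of_nonneg_of_le (fun k => integral_nonneg fun _ => norm_nonneg _) (fun k => ?_)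
      ((summable_geometric_of_lt_one (by positivity) hx2).mul_left
        (B * (1 - ((p : ℝ) ^ 2)⁻¹) * ‖(p : ℂ) ^ (((2 * N : ℕ) : ℂ) * s)‖))
    have hbound := norm_setIntegral_le_of_norm_le_const (μ := μ.prod μ) (s := T k)
      (f := fun q => ‖f s q‖)
      (C := B * ‖(p : ℂ) ^ (2 * (((N : ℤ) - k : ℤ) : ℂ) * (s - 1))‖)
      ((measure_mono Metric.sphere_subset_closedBall).trans_lt measure_closedBall_lt_top)
      (fun q hq => by
        rw [norm_norm, hfT s k q hq, norm_mul]
        gcongr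
        exact hB q)
    refine (Real.le_norm_self _).trans (hbound.trans (le_of_eq ?_))
    rw [hvol, Complex.cpow_two_mul_sub_mul hp0, norm_mul, norm_mul, norm_pow, norm_zpow, norm_zpow,
      Complex.norm_natCast, zpow_neg, pow_mul]
    have : (p : ℝ) ^ ((N : ℤ) - k) ≠ 0 := by positivity
    norm_cast
    field_simp
  refine ⟨hint, 2 * N, ?_⟩
  let b (k : ℕ) : ℂ := (∫ q in T k, Φ q ∂(μ.prod μ)) * ((p : ℂ) ^ ((N : ℤ) - k)) ^ (-2 : ℤ)
  have hb (k : ℕ) (hk : K ≤ k) : b k = Φ 0 * (1 - ((p : ℂ) ^ 2)⁻¹) := by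
    have h1 : ∫ q in T k, Φ q ∂(μ.prod μ) = ∫ q in T k, Φ 0 ∂(μ.prod μ) := by
      refine setIntegral_congr_fun (hTm k) fun q hq => hK q ?_
      rw [mem_sphere_zero_iff_norm] at hq
      rw [hq, zpow_le_zpow_iff_right₀ hp1]
      lia
    have h2 : (p : ℂ) ^ ((N : ℤ) - k) ≠ 0 := zpow_ne_zero _ hpC
    simp only [b]
    rw [h1, setIntegral_const, hvol, Complex.real_smul, zpow_neg]
    push_cast
    norm_cast at h2 ⊢
    field_simp
  refine ⟨(1 - Polynomial.X ^ 2) *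
      ∑ k ∈ Finset.range K, Polynomial.C (b k) * Polynomial.X ^ (2 * k) +
    Polynomial.C (Φ 0 * (1 - ((p : ℂ) ^ 2)⁻¹)) * Polynomial.X ^ (2 * K), fun s hs => ?_⟩
  have hsum := hasSum_integral_iUnion hTm hTd (hint s hs).integrableOn
  rw [setIntegral_eq_integral_of_forall_compl_eq_zero fun q hq =>
    Function.notMem_support.mp fun h => hq (hfsupp s h)] at hsum
  have hterm (k : ℕ) : ∫ q in T k, f s q ∂(μ.prod μ) =
      b k * ((p : ℂ) ^ (((2 * N : ℕ) : ℂ) * s) * ((p : ℂ) ^ (-s)) ^ (2 * k)) := by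
    rw [setIntegral_congr_fun (hTm k) (hfT s k), integral_mul_const,
      Complex.cpow_two_mul_sub_mul hp0, mul_assoc]
  simp_rw [hterm] at hsum
  have hx2 : (p : ℂ) ^ (-(2 * s)) = ((p : ℂ) ^ (-s)) ^ 2 := by
    rw [← Complex.cpow_nat_mul]
    congr 1
    push_cast
    ring
  rw [hx2]
  exact one_sub_sq_mul_of_hasSum_eventually_const hb (hx s hs) hsum
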